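/- Let U be an update family such that for some u ∈ S¹ both u and −u belong to int S(U) (that is, U has two opposite strongly stable directions). Then p_c(ℤ², U) > 0. -/

import Mathlib

open Set MeasureTheory

/-- A site of the two-dimensional lattice. -/
abbrev Site : Type := ℤ × ℤ

/-- One step of the `U`-bootstrap process. -/
def bsStep (U : Finset (Finset Site)) (A : Set Site) : Set Site :=
  A ∪ {x : Site | ∃ X ∈ U, ∀ y ∈ X, y + x ∈ A}

/-- The `t`-th stage of the `U`-bootstrap process started from `A`. -/
def bsIter (U : Finset (Finset Site)) : ℕ → Set Site → Set Site
  | 0, A => A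
  | n + 1, A => bsStep U (bsIter U n A)

/-- The closure `[A]` under the `U`-bootstrap process. -/
def bsClosure (U : Finset (Finset Site)) (A : Set Site) : Set Site :=
  ⋃ n : ℕ, bsIter U n A

/-- `U` is an update family: a (finite) collection of finite nonempty subsets of `ℤ² \ {0}`. -/
def IsUpdateFamily (U : Finset (Finset Site)) : Prop :=
  U.Nonempty ∧ ∀ X ∈ U, X.Nonempty ∧ (0 : Site) ∉ X

/-- The discrete half-plane `H_u` determined by `u ∈ ℝ²`. -/
def halfPlane (u : ℝ × ℝ) : Set Site :=
  {x : Site | (x.1 : ℝ) * u.1 + (x.2 : ℝ) * u.2 < 0}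

/-- A direction `u` is stable for `U` if `[H_u] = H_u`. -/
def IsStableDir (U : Finset (Finset Site)) (u : ℝ × ℝ) : Prop :=
  bsClosure U (halfPlane u) = halfPlane u

/-- The unit vector of angle `θ`. -/
noncomputable def dir (θ : ℝ) : ℝ × ℝ := (Real.cos θ, Real.sin θ)

/-- `dir θ` lies in the interior of the stable set (is strongly stable). -/
def IsStronglyStableAngle (U : Finset (Finset Site)) (θ : ℝ) : Prop :=
  ∃ ε > 0, ∀ φ : ℝ, |φ - θ| < ε → IsStableDir U (dir φ)

/-- `U` is subcritical: every open semicircle contains a strongly stable direction. -/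
def Subcritical (U : Finset (Finset Site)) : Prop :=
  ∀ θ : ℝ, ∃ φ : ℝ, θ < φ ∧ φ < θ + Real.pi ∧ IsStronglyStableAngle U φ

/-- `U` is supercritical: some open semicircle contains no stable direction. -/
def Supercritical (U : Finset (Finset Site)) : Prop :=
  ∃ θ : ℝ, ∀ φ : ℝ, θ < φ → φ < θ + Real.pi → ¬ IsStableDir U (dir φ)

/-- The random set of infected sites determined by `ω`. -/
def siteSet (ω : Site → Bool) : Set Site := {x : Site | ω x = true}

/-- `μ` is the Bernoulli product measure with density `p` on `ℤ²`:
each site lies in the random set independently with probability `p`. -/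
def IsBernoulli (p : ℝ) (μ : Measure (Site → Bool)) : Prop :=
  ∀ (s : Finset Site) (f : Site → Bool),
    μ {ω : Site → Bool | ∀ x ∈ s, ω x = f x}
      = ∏ x ∈ s, ENNReal.ofReal (if f x then p else 1 - p)

/-- `A` percolates: its closure is all of `ℤ²`. -/
def Percolates (U : Finset (Finset Site)) (A : Set Site) : Prop :=
  bsClosure U A = Set.univ

/-- The critical probability `p_c(ℤ², U)`. -/
noncomputable def critProb (U : Finset (Finset Site)) : ℝ :=
  sInf {p : ℝ | p ∈ Set.Icc (0 : ℝ) 1 ∧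
    ∀ μ : Measure (Site → Bool), IsBernoulli p μ →
      μ {ω : Site → Bool | Percolates U (siteSet ω)} = 1}

/-- Euclidean embedding of the lattice into the complex plane. -/
noncomputable def toC (v : Site) : ℂ := ⟨(v.1 : ℝ), (v.2 : ℝ)⟩

/-- The range `r(U)`: the largest Euclidean distance between two sites of one update rule. -/
noncomputable def famRange (U : Finset (Finset Site)) : ℝ :=
  (U.sup fun X => X.sup fun a => X.sup fun b => nndist (toC a) (toC b) : NNReal)

/-- The `ℓ¹` norm of a site. -/
def siteNorm (x : Site) : ℕ := x.1.natAbs + x.2.natAbs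

/-- The linear functional `⟨·, dir φ⟩` on the lattice. -/
noncomputable def height (φ : ℝ) (x : Site) : ℝ :=
  (x.1 : ℝ) * Real.cos φ + (x.2 : ℝ) * Real.sin φ

theorem siteNorm_add_le (x y : Site) : siteNorm (x + y) ≤ siteNorm x + siteNorm y := by
  simp only [siteNorm, Prod.fst_add, Prod.snd_add]
  omega

theorem height_add (φ : ℝ) (x y : Site) : height φ (x + y) = height φ x + height φ y := by
  simp only [height, Prod.fst_add, Prod.snd_add, Int.cast_add]
  ring

theorem height_neg (φ : ℝ) (x : Site) : height φ (-x) = -height φ x := by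
  simp only [height, Prod.fst_neg, Prod.snd_neg, Int.cast_neg]
  ring

theorem height_sub (φ : ℝ) (x y : Site) : height φ (x - y) = height φ x - height φ y := by
  rw [sub_eq_add_neg, height_add, height_neg, sub_eq_add_neg]

theorem siteNorm_neg (x : Site) : siteNorm (-x) = siteNorm x := by
  simp [siteNorm]

/-- If `u` is a stable direction, then no update rule is contained in `H_u`. -/
theorem IsStableDir.exists_height_nonneg {U : Finset (Finset Site)} {φ : ℝ}
    (h : IsStableDir U (dir φ)) {X : Finset Site} (hX : X ∈ U) :
    ∃ y ∈ X, 0 ≤ height φ y := by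
  by_contra! hneg
  have h0 : (0 : Site) ∈ bsClosure U (halfPlane (dir φ)) :=
    mem_iUnion.2 ⟨1, Or.inr ⟨X, hX, fun y hy => by
      rw [add_zero]; exact hneg y hy⟩⟩
  rw [h] at h0
  simp [halfPlane] at h0

/-- A nonzero site is orthogonal to at most one direction in a range of angles of length `π`. -/
theorem subsingleton_height_eq_zero {y : Site} (hy : y ≠ 0) {a b : ℝ} (hab : b - a ≤ Real.pi) :
    {φ ∈ Ioo a b | height φ y = 0}.Subsingleton := by
  rintro φ ⟨hφ, h⟩ ψ ⟨hψ, h'⟩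
  simp only [height] at h h'
  have h1 : (y.1 : ℝ) * Real.sin (φ - ψ) = 0 := by
    rw [Real.sin_sub]
    linear_combination Real.sin φ * h' - Real.sin ψ * h
  have h2 : (y.2 : ℝ) * Real.sin (φ - ψ) = 0 := by
    rw [Real.sin_sub]
    linear_combination Real.cos ψ * h - Real.cos φ * h'
  have hs : Real.sin (φ - ψ) = 0 := by
    by_contra hs
    apply hy
    ext
    · exact_mod_cast (mul_eq_zero.1 h1).resolve_right hs
    · exact_mod_cast (mul_eq_zero.1 h2).resolve_right hs
  have := (Real.sin_eq_zero_iff_of_lt_of_lt (by linarith [hφ.1, hψ.2])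
    (by linarith [hφ.2, hψ.1])).1 hs
  linarith

/-- Two opposite strongly stable directions can be perturbed so that every update rule has
sites strictly on both sides of the line orthogonal to them, and none on that line. -/
theorem exists_generic_angle {U : Finset (Finset Site)} (hU : IsUpdateFamily U) {θ : ℝ}
    (h₁ : IsStronglyStableAngle U θ) (h₂ : IsStronglyStableAngle U (θ + Real.pi)) :
    ∃ φ : ℝ, ∀ X ∈ U, (∀ y ∈ X, height φ y ≠ 0) ∧ (∃ y ∈ X, 0 < height φ y) ∧
      ∃ y ∈ X, height φ y < 0 := by
  obtain ⟨ε₁, hε₁, h₁⟩ := h₁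
  obtain ⟨ε₂, hε₂, h₂⟩ := h₂
  obtain ⟨b, hb, hb'⟩ : ∃ b > 0, b ≤ ε₁ ∧ b ≤ ε₂ ∧ b ≤ Real.pi :=
    ⟨min ε₁ (min ε₂ Real.pi), by positivity, by simp, by simp, by simp⟩
  have hfin : (⋃ y ∈ U.biUnion id, {φ ∈ Ioo θ (θ + b) | height φ y = 0}).Finite := by
    refine Set.Finite.biUnion (Finset.finite_toSet _) fun y hy => ?_
    obtain ⟨X, hX, hyX⟩ := Finset.mem_biUnion.1 hy
    refine (subsingleton_height_eq_zero ?_ (by linarith)).finite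
    rintro rfl
    exact (hU.2 X hX).2 hyX
  obtain ⟨φ, hφ, hφ'⟩ := (Ioo_infinite (show θ < θ + b by linarith)).exists_notMem_finite hfin
  have hne : ∀ X ∈ U, ∀ y ∈ X, height φ y ≠ 0 := fun X hX y hy h0 =>
    hφ' (mem_biUnion (Finset.mem_biUnion.2 ⟨X, hX, hy⟩) ⟨hφ, h0⟩)
  refine ⟨φ, fun X hX => ⟨hne X hX, ?_, ?_⟩⟩
  · obtain ⟨y, hy, h⟩ := (h₁ φ (by rw [abs_lt]; constructor <;> linarith [hφ.1, hφ.2]))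
      |>.exists_height_nonneg hX
    exact ⟨y, hy, h.lt_of_ne' (hne X hX y hy)⟩
  · obtain ⟨y, hy, h⟩ := (h₂ (φ + Real.pi)
      (by rw [abs_lt]; constructor <;> linarith [hφ.1, hφ.2])).exists_height_nonneg hX
    refine ⟨y, hy, lt_of_le_of_ne ?_ (hne X hX y hy)⟩
    simp only [height, Real.cos_add_pi, Real.sin_add_pi] at h ⊢
    linarith

/-- From a chain one can extract a duplicate-free chain with the same end points. -/
theorem exists_nodup_isChain {α : Type*} {R : α → α → Prop} (l : List α) (hl : l.IsChain R) :
    ∃ l' : List α, l' ⊆ l ∧ l'.Nodup ∧ l'.IsChain R ∧ l'.head? = l.head? ∧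
      l'.getLast? = l.getLast? := by
  classical
  induction l with
  | nil => exact ⟨[], by simp⟩
  | cons a t ih =>
    obtain ⟨t', hsub, hnd, hch, hhead, hlast⟩ := ih hl.tail
    by_cases ha : a ∈ t'
    · obtain ⟨p, q, rfl⟩ := List.append_of_mem ha
      refine ⟨a :: q, fun x hx => List.mem_cons_of_mem _ (hsub (List.mem_append_right _ hx)),
        (List.nodup_append.1 hnd).2.1, (List.isChain_append.1 hch).2.1, rfl, ?_⟩
      rw [List.getLast?_append] at hlast
      cases t with
      | nil => simp at hlast
      | cons b t =>
        rw [List.getLast?_cons_cons, ← hlast, List.getLast?_cons]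
        simp
    · refine ⟨a :: t', List.cons_subset_cons _ hsub, List.nodup_cons.2 ⟨ha, hnd⟩, ?_, rfl, ?_⟩
      · rw [List.isChain_cons] at hl ⊢
        exact ⟨by rw [hhead]; exact hl.1, hch⟩
      · rw [List.getLast?_cons, List.getLast?_cons, hlast]

/-- An infected site `x` is linked, by a chain of initially infected sites that starts and ends
near `x`, where the distance of consecutive sites is controlled by their height difference. -/
theorem exists_isChain_of_mem_bsIter {U : Finset (Finset Site)} {φ α β : ℝ}
    (hβ : ∀ X ∈ U, ∃ y ∈ X, ∃ z ∈ X, siteNorm y ≤ β * height φ y ∧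
      siteNorm z ≤ -(β * height φ z) ∧ siteNorm (z - y) ≤ α + β * height φ (z - y))
    (A : Set Site) (n : ℕ) (x : Site) (hx : x ∈ bsIter U n A) :
    ∃ l : List Site, l ≠ [] ∧ (∀ s ∈ l, s ∈ A) ∧
      l.IsChain (fun s t => (siteNorm (t - s) : ℝ) ≤ α + β * height φ (t - s)) ∧
      (∀ s ∈ l.head?, (siteNorm (s - x) : ℝ) ≤ β * height φ (s - x)) ∧
      ∀ s ∈ l.getLast?, (siteNorm (x - s) : ℝ) ≤ β * height φ (x - s) := by
  induction n generalizing x with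
  | zero =>
    have hxA : x ∈ A := hx
    exact ⟨[x], by simp [siteNorm, height, hxA]⟩
  | succ n ih =>
    rcases hx with hx | ⟨X, hX, hx⟩
    · exact ih x hx
    obtain ⟨y, hy, z, hz, hyβ, hzβ, hyz⟩ := hβ X hX
    obtain ⟨l, hl, hlA, hlc, hlh, hll⟩ := ih _ (hx y hy)
    obtain ⟨m, hm, hmA, hmc, hmh, hml⟩ := ih _ (hx z hz)
    refine ⟨l ++ m, by simp [hl], fun s hs => (List.mem_append.1 hs).elim (hlA s) (hmA s),
      List.isChain_append.2 ⟨hlc, hmc, fun s hs t ht => ?_⟩, fun s hs => ?_, fun s hs => ?_⟩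
    · have h₁ := hll s hs
      have h₂ := hmh t ht
      have e : t - s = (t - (z + x)) + ((z - y) + (y + x - s)) := by abel
      have h₃ := siteNorm_add_le (t - (z + x)) ((z - y) + (y + x - s))
      have h₄ := siteNorm_add_le (z - y) (y + x - s)
      rw [← e] at h₃
      have h₅ : (siteNorm (t - s) : ℝ) ≤
          siteNorm (t - (z + x)) + (siteNorm (z - y) + siteNorm (y + x - s)) := by
        exact_mod_cast h₃.trans (by omega)
      simp only [height_sub, height_add] at *
      linarith
    · have hs' : s ∈ l.head? := by
        rwa [List.head?_append_of_ne_nil _ hl] at hs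
      have h₁ := hlh s hs'
      have e : s - x = (s - (y + x)) + y := by abel
      have h₃ := siteNorm_add_le (s - (y + x)) y
      rw [← e] at h₃
      have h₅ : (siteNorm (s - x) : ℝ) ≤ siteNorm (s - (y + x)) + siteNorm y := by
        exact_mod_cast h₃
      simp only [height_sub, height_add] at *
      linarith
    · have hs' : s ∈ m.getLast? := by
        rwa [List.getLast?_append_of_ne_nil _ hm] at hs
      have h₁ := hml s hs'
      have e : x - s = (z + x - s) + -z := by abel
      have h₃ := siteNorm_add_le (z + x - s) (-z)
      rw [← e, siteNorm_neg] at h₃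
      have h₅ : (siteNorm (x - s) : ℝ) ≤ siteNorm (z + x - s) + siteNorm z := by
        exact_mod_cast h₃
      simp only [height_sub, height_add] at *
      linarith

/-- The `ℓ¹` length of the path that starts at `a` and visits the given sites in turn. -/
def pathLength : Site → List Site → ℕ
  | _, [] => 0
  | a, s :: l => siteNorm (s - a) + pathLength s l

theorem pathLength_le {φ α β : ℝ} (l : List Site) (s e : Site)
    (hl : (s :: l).IsChain (fun s t => (siteNorm (t - s) : ℝ) ≤ α + β * height φ (t - s)))
    (he : e ∈ (s :: l).getLast?) :
    (pathLength s l : ℝ) ≤ α * l.length + β * height φ (e - s) := by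
  induction l generalizing s with
  | nil =>
    obtain rfl : s = e := by simpa using he
    simp [pathLength, height]
  | cons t l ih =>
    rw [List.isChain_cons_cons] at hl
    have := ih t hl.2 (by rwa [List.getLast?_cons_cons] at he)
    have := hl.1
    simp only [pathLength, height_sub, List.length_cons] at *
    push_cast
    linarith

/-- For a family with two opposite strongly stable directions, an infected origin forces a short
path through distinct initially infected sites. -/
theorem exists_short_path {U : Finset (Finset Site)} (hU : IsUpdateFamily U) {θ : ℝ}
    (h₁ : IsStronglyStableAngle U θ) (h₂ : IsStronglyStableAngle U (θ + Real.pi)) :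
    ∃ K : ℕ, ∀ A : Set Site, (0 : Site) ∈ bsClosure U A →
      ∃ l : List Site, l ≠ [] ∧ l.Nodup ∧ (∀ s ∈ l, s ∈ A) ∧
        pathLength 0 l ≤ K * l.length := by
  obtain ⟨φ, hφ⟩ := exists_generic_angle hU h₁ h₂
  obtain ⟨β, hβ⟩ := ((U.biUnion id).image fun y => (siteNorm y : ℝ) / |height φ y|).exists_le
  obtain ⟨α, hα⟩ := ((U.biUnion id ×ˢ U.biUnion id).image fun q : Site × Site =>
    (siteNorm (q.2 - q.1) : ℝ) - β * height φ (q.2 - q.1)).exists_le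
  have hβ' : ∀ X ∈ U, ∀ y ∈ X, (siteNorm y : ℝ) ≤ β * |height φ y| := fun X hX y hy =>
    (div_le_iff₀ (abs_pos.2 ((hφ X hX).1 y hy))).1
      (hβ _ (Finset.mem_image_of_mem _ (Finset.mem_biUnion.2 ⟨X, hX, hy⟩)))
  have hrule : ∀ X ∈ U, ∃ y ∈ X, ∃ z ∈ X, (siteNorm y : ℝ) ≤ β * height φ y ∧
      (siteNorm z : ℝ) ≤ -(β * height φ z) ∧
      (siteNorm (z - y) : ℝ) ≤ α + β * height φ (z - y) := by
    intro X hX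
    obtain ⟨-, ⟨y, hy, hy0⟩, z, hz, hz0⟩ := hφ X hX
    refine ⟨y, hy, z, hz, ?_, ?_, ?_⟩
    · simpa [abs_of_pos hy0] using hβ' X hX y hy
    · simpa [abs_of_neg hz0] using hβ' X hX z hz
    · have := hα _ (Finset.mem_image_of_mem _ (Finset.mk_mem_product
        (Finset.mem_biUnion.2 ⟨X, hX, hy⟩) (Finset.mem_biUnion.2 ⟨X, hX, hz⟩)))
      simp only at this
      linarith
  refine ⟨⌈α⌉₊, fun A hA => ?_⟩
  obtain ⟨n, hn⟩ := mem_iUnion.1 hA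
  obtain ⟨l₀, hne, hA₀, hc₀, hh₀, ht₀⟩ := exists_isChain_of_mem_bsIter hrule A n 0 hn
  obtain ⟨l, hsub, hnd, hc, hh, ht⟩ := exists_nodup_isChain l₀ hc₀
  rw [← hh] at hh₀
  rw [← ht] at ht₀
  cases l with
  | nil =>
    rw [List.head?_nil, eq_comm, List.head?_eq_none_iff] at hh
    exact absurd hh hne
  | cons s l =>
    refine ⟨s :: l, by simp, hnd, fun t ht' => hA₀ t (hsub ht'), ?_⟩
    obtain ⟨e, he⟩ : ∃ e, e ∈ (s :: l).getLast? := ⟨_, List.getLast?_cons⟩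
    have h₁ := pathLength_le l s e hc he
    have h₂ := hh₀ s (by simp)
    have h₃ := ht₀ e he
    have h₄ : α ≤ ⌈α⌉₊ := Nat.le_ceil α
    have h₅ : (0 : ℝ) ≤ siteNorm (0 - e) := Nat.cast_nonneg _
    have h₆ : (0 : ℝ) ≤ ⌈α⌉₊ := Nat.cast_nonneg _
    have h₇ := mul_le_mul_of_nonneg_right h₄ (Nat.cast_nonneg (α := ℝ) l.length)
    have h₈ : height φ 0 = 0 := by simp [height]
    have : (pathLength 0 (s :: l) : ℝ) ≤ ⌈α⌉₊ * (s :: l).length := by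
      simp only [pathLength, List.length_cons, height_sub, h₈] at *
      push_cast
      linarith
    exact_mod_cast this

/-- The weight `2 ^ (-‖x‖₁)` of a site. -/
noncomputable def siteWeight (x : Site) : ENNReal := 2⁻¹ ^ siteNorm x

theorem tsum_siteWeight_ne_top : ∑' x : Site, siteWeight x ≠ ⊤ := by
  have hs : Summable fun n : ℤ => (2⁻¹ : ℝ) ^ n.natAbs :=
    Summable.of_nat_of_neg (by simpa using summable_geometric_two)
      (by simpa using summable_geometric_two)
  have hZ : ∑' n : ℤ, (2⁻¹ : ENNReal) ^ n.natAbs ≠ ⊤ := by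
    convert hs.tsum_ofReal_ne_top using 4 with n
    rw [ENNReal.ofReal_pow (by positivity), ENNReal.ofReal_inv_of_pos (by norm_num)]
    simp
  have : ∑' x : Site, siteWeight x =
      (∑' n : ℤ, (2⁻¹ : ENNReal) ^ n.natAbs) * ∑' n : ℤ, (2⁻¹ : ENNReal) ^ n.natAbs := by
    simp only [siteWeight, siteNorm, pow_add]
    rw [ENNReal.tsum_prod (f := fun a b : ℤ => (2⁻¹ : ENNReal) ^ a.natAbs * 2⁻¹ ^ b.natAbs)]
    simp only [ENNReal.tsum_mul_left, ENNReal.tsum_mul_right]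
  rw [this]
  exact ENNReal.mul_ne_top hZ hZ

theorem tsum_pathLength (n : ℕ) (a : Site) :
    ∑' s : Fin n → Site, (2⁻¹ : ENNReal) ^ pathLength a (List.ofFn s) =
      (∑' x : Site, siteWeight x) ^ n := by
  induction n generalizing a with
  | zero => simp [pathLength, tsum_fintype]
  | succ n ih =>
    rw [← (Fin.consEquiv fun _ : Fin (n + 1) => Site).tsum_eq,
      ENNReal.tsum_prod (f := fun x s => (2⁻¹ : ENNReal) ^ pathLength a
        (List.ofFn ((Fin.consEquiv fun _ : Fin (n + 1) => Site) (x, s))))]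
    have hcons : ∀ x s, (2⁻¹ : ENNReal) ^ pathLength a
        (List.ofFn ((Fin.consEquiv fun _ : Fin (n + 1) => Site) (x, s))) =
          siteWeight (x - a) * 2⁻¹ ^ pathLength x (List.ofFn s) := fun x s => by
      rw [siteWeight, ← pow_add, List.ofFn_succ]
      rfl
    simp only [hcons, ENNReal.tsum_mul_left, ih, ENNReal.tsum_mul_right]
    rw [pow_succ', ← (Equiv.subRight a).tsum_eq siteWeight]
    simp only [Equiv.subRight_apply]

/-- Peierls bound: short paths through `n` distinct sites of a Bernoulli set are unlikely. -/
theorem IsBernoulli.measure_short_path_le {p : ℝ} {μ : Measure (Site → Bool)}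
    (hμ : IsBernoulli p μ) (K n : ℕ) :
    μ {ω | ∃ l : List Site, l.length = n ∧ l.Nodup ∧ (∀ s ∈ l, s ∈ siteSet ω) ∧
      pathLength 0 l ≤ K * l.length} ≤
      (ENNReal.ofReal p * 2 ^ K * ∑' x : Site, siteWeight x) ^ n := by
  set E : (Fin n → Site) → Set (Site → Bool) := fun s =>
    {ω | (List.ofFn s).Nodup ∧ (∀ x ∈ List.ofFn s, x ∈ siteSet ω) ∧
      pathLength 0 (List.ofFn s) ≤ K * n} with hE
  have hsub : {ω | ∃ l : List Site, l.length = n ∧ l.Nodup ∧ (∀ s ∈ l, s ∈ siteSet ω) ∧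
      pathLength 0 l ≤ K * l.length} ⊆ ⋃ s, E s := by
    rintro ω ⟨l, rfl, h⟩
    refine mem_iUnion.2 ⟨l.get, ?_⟩
    simpa only [hE, mem_ofPred_eq, List.ofFn_get] using h
  have hle : ∀ s, μ (E s) ≤
      ENNReal.ofReal p ^ n * (2 ^ (K * n) * 2⁻¹ ^ pathLength 0 (List.ofFn s)) := by
    intro s
    by_cases h : (List.ofFn s).Nodup ∧ pathLength 0 (List.ofFn s) ≤ K * n
    · have h1 : μ (E s) ≤ ENNReal.ofReal p ^ n := by
        refine (measure_mono fun ω hω => ?_).trans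
          (hμ (List.ofFn s).toFinset fun _ => true).le |>.trans ?_
        · exact fun x hx => hω.2.1 x (List.mem_toFinset.1 hx)
        · simp [List.toFinset_card_of_nodup h.1]
      refine h1.trans (le_mul_of_one_le_right' ?_)
      obtain ⟨k, hk⟩ := Nat.exists_eq_add_of_le h.2
      rw [hk, pow_add, mul_right_comm, ← mul_pow,
        ENNReal.mul_inv_cancel (by simp) (by simp), one_pow, one_mul]
      exact one_le_pow₀ (by norm_num)
    · have : E s = ∅ := eq_empty_of_forall_notMem fun ω hω => h ⟨hω.1, hω.2.2⟩
      simp [this]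
  calc _ ≤ μ (⋃ s, E s) := measure_mono hsub
    _ ≤ ∑' s, μ (E s) := measure_iUnion_le _
    _ ≤ ∑' s, ENNReal.ofReal p ^ n * (2 ^ (K * n) * 2⁻¹ ^ pathLength 0 (List.ofFn s)) :=
      ENNReal.tsum_le_tsum hle
    _ = _ := by
      rw [ENNReal.tsum_mul_left, ENNReal.tsum_mul_left, tsum_pathLength, pow_mul, ← mul_assoc,
        ← mul_pow, ← mul_pow]

theorem exists_isBernoulli {p : ℝ} (hp : p ∈ Icc (0 : ℝ) 1) :
    ∃ μ : Measure (Site → Bool), IsBernoulli p μ := by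
  set ν : Measure Bool := ENNReal.ofReal p • Measure.dirac true +
    ENNReal.ofReal (1 - p) • Measure.dirac false with hν
  have : IsProbabilityMeasure ν := ⟨by
    simp [hν, ← ENNReal.ofReal_add hp.1 (sub_nonneg.2 hp.2)]⟩
  refine ⟨Measure.infinitePi fun _ => ν, fun s f => ?_⟩
  have : {ω : Site → Bool | ∀ x ∈ s, ω x = f x} = Set.pi s fun x => {f x} := by
    ext; simp [Set.mem_pi]
  rw [this, Measure.infinitePi_pi _ fun _ _ => MeasurableSet.singleton _]
  refine Finset.prod_congr rfl fun x _ => ?_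
  cases f x <;> simp [hν]

theorem IsBernoulli.measure_percolates_of_one (U : Finset (Finset Site))
    {μ : Measure (Site → Bool)} (hμ : IsBernoulli 1 μ) :
    μ {ω | Percolates U (siteSet ω)} = 1 := by
  have huniv : μ univ = 1 := by simpa using hμ ∅ fun _ => true
  have hae : ∀ᵐ ω ∂μ, ∀ x, ω x = true := by
    refine ae_all_iff.2 fun x => ?_
    rw [ae_iff]
    simpa using hμ {x} fun _ => false
  have : {ω | Percolates U (siteSet ω)} =ᵐ[μ] univ := by
    refine Filter.eventuallyEq_univ.2 (hae.mono fun ω hω => ?_)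
    refine eq_univ_of_forall fun x => mem_iUnion.2 ⟨0, hω x⟩
  rw [measure_congr this, huniv]

/-- Let `U` be an update family with two opposite strongly stable
directions, i.e. there is `u ∈ S¹` with `u, -u ∈ int S(U)` (here `u = dir θ` and
`-u = dir (θ + π)`). Then `p_c(ℤ², U) > 0`. -/
theorem symmetric_critProb_pos
    (U : Finset (Finset Site)) (hU : IsUpdateFamily U)
    (hsym : ∃ θ : ℝ, IsStronglyStableAngle U θ ∧ IsStronglyStableAngle U (θ + Real.pi)) :
    0 < critProb U := by
  obtain ⟨θ, h₁, h₂⟩ := hsym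
  obtain ⟨K, hK⟩ := exists_short_path hU h₁ h₂
  set W := ∑' x : Site, siteWeight x with hW
  have hC : 2 ^ K * W ≠ ⊤ := ENNReal.mul_ne_top (by simp) tsum_siteWeight_ne_top
  set C := (2 ^ K * W).toReal with hCdef
  have hC0 : 0 ≤ C := ENNReal.toReal_nonneg
  have hp₀ : 0 < 1 / (3 * (C + 1)) := by positivity
  refine hp₀.trans_le (le_csInf ⟨1, by simp, fun μ hμ => hμ.measure_percolates_of_one U⟩ ?_)
  rintro p ⟨hp, hperc⟩
  by_contra! hlt
  obtain ⟨μ, hμ⟩ := exists_isBernoulli hp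
  have hr : ENNReal.ofReal p * 2 ^ K * W ≤ 3⁻¹ := by
    rw [mul_assoc, ← ENNReal.ofReal_toReal hC, ← ENNReal.ofReal_mul hp.1,
      show (3⁻¹ : ENNReal) = ENNReal.ofReal 3⁻¹ by
        rw [ENNReal.ofReal_inv_of_pos (by norm_num)]; simp]
    apply ENNReal.ofReal_le_ofReal
    rw [lt_div_iff₀ (by positivity)] at hlt
    rw [← hCdef]
    linarith [hp.1]
  have hsub : {ω | Percolates U (siteSet ω)} ⊆ ⋃ n : ℕ, {ω | ∃ l : List Site,
      l.length = n + 1 ∧ l.Nodup ∧ (∀ s ∈ l, s ∈ siteSet ω) ∧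
      pathLength 0 l ≤ K * l.length} := by
    intro ω hω
    obtain ⟨l, hne, h⟩ := hK (siteSet ω) (by
      rw [show bsClosure U (siteSet ω) = univ from hω]; trivial)
    refine mem_iUnion.2 ⟨l.length - 1, l, ?_, h⟩
    have := List.length_pos_of_ne_nil hne
    omega
  have hbound : μ {ω | Percolates U (siteSet ω)} ≤ 2⁻¹ :=
    calc _ ≤ _ := measure_mono hsub
      _ ≤ _ := measure_iUnion_le _
      _ ≤ ∑' n : ℕ, (3⁻¹ : ENNReal) ^ (n + 1) := ENNReal.tsum_le_tsum fun n =>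
        (hμ.measure_short_path_le K (n + 1)).trans (pow_le_pow_left' hr _)
      _ = 2⁻¹ := by
        rw [ENNReal.tsum_geometric_add_one]
        have : (1 - 3⁻¹ : ENNReal) = 2 * 3⁻¹ := by
          refine ENNReal.sub_eq_of_eq_add (by simp) ?_
          rw [← add_one_mul, two_add_one_eq_three, ENNReal.mul_inv_cancel (by simp) (by simp)]
        rw [this, ENNReal.mul_inv (by simp) (by simp), inv_inv, mul_left_comm,
          ENNReal.inv_mul_cancel (by simp) (by simp), mul_one]
  rw [hperc μ hμ] at hbound
  exact absurd hbound (by norm_num)
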